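/- For every 3-periodic billiard orbit P₁P₂P₃ in the ellipse E, the inradius and circumradius satisfy the bounds b²(δ − b²)/(c²·a) ≤ r ≤ a²(a² − δ)/(c²·b) and (a² + δ)/(2a) ≤ R ≤ (b² + δ)/(2b), with the lower (resp. upper) bounds attained exactly at the isosceles orbits having a vertex at (±a, 0) (resp. at (0, ±b)). -/

import Mathlib

noncomputable section

open EuclideanGeometry Real

/-- Points of the plane. -/
abbrev Pt := EuclideanSpace ℝ (Fin 2)

/-- Membership in the billiard ellipse `x²/a² + y²/b² = 1`. -/
def onEllipse (a b : ℝ) (P : Pt) : Prop :=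
  (P 0) ^ 2 / a ^ 2 + (P 1) ^ 2 / b ^ 2 = 1

/-- Billiard reflection law at vertex `P` (other vertices `Q`, `R`): the sum of the two
unit vectors from `P` towards `Q` and `R` is orthogonal to the tangent direction
`(-P.y/b², P.x/a²)` of the ellipse at `P`. -/
def reflects (a b : ℝ) (P Q R : Pt) : Prop :=
  (‖Q - P‖⁻¹ • (Q - P) + ‖R - P‖⁻¹ • (R - P)) 0 * (-(P 1) / b ^ 2) +
  (‖Q - P‖⁻¹ • (Q - P) + ‖R - P‖⁻¹ • (R - P)) 1 * ((P 0) / a ^ 2) = 0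

/-- `P₁P₂P₃` is a 3-periodic billiard orbit in the ellipse with semiaxes `a`, `b`:
pairwise distinct points on the ellipse satisfying the reflection law at every vertex. -/
def IsOrbit (a b : ℝ) (P₁ P₂ P₃ : Pt) : Prop :=
  P₁ ≠ P₂ ∧ P₂ ≠ P₃ ∧ P₁ ≠ P₃ ∧
  onEllipse a b P₁ ∧ onEllipse a b P₂ ∧ onEllipse a b P₃ ∧
  reflects a b P₁ P₂ P₃ ∧ reflects a b P₂ P₃ P₁ ∧ reflects a b P₃ P₁ P₂

lemma sq_eq_one_iff_or (x : ℝ) (h : x ^ 2 = 1) : x = 1 ∨ x = -1 := by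
  have : (x - 1) * (x + 1) = 0 := by linear_combination h
  rcases mul_eq_zero.1 this with h | h
  · left; linarith
  · right; linarith

lemma refl_core (a b X Y X2 Y2 X3 Y3 s t : ℝ) (ha : 0 < a) (hb : 0 < b)
    (h1 : X ^ 2 + Y ^ 2 = 1)
    (hD2 : 0 < 1 - X * X2 - Y * Y2) (hD3 : 0 < 1 - X * X3 - Y * Y3)
    (hs : 0 < s) (ht : 0 < t)
    (hs2 : s ^ 2 = a ^ 2 * (X2 - X) ^ 2 + b ^ 2 * (Y2 - Y) ^ 2)
    (ht2 : t ^ 2 = a ^ 2 * (X3 - X) ^ 2 + b ^ 2 * (Y3 - Y) ^ 2)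
    (hr : (s⁻¹ * (a * X2 - a * X) + t⁻¹ * (a * X3 - a * X)) * (-(b * Y) / b ^ 2) +
      (s⁻¹ * (b * Y2 - b * Y) + t⁻¹ * (b * Y3 - b * Y)) * ((a * X) / a ^ 2) = 0) :
    (1 - X * X2 - Y * Y2) / s = (1 - X * X3 - Y * Y3) / t := by
  set U := (-(a ^ 2 * Y * (X2 - X)) + b ^ 2 * X * (Y2 - Y)) with hU
  set V := (-(a ^ 2 * Y * (X3 - X)) + b ^ 2 * X * (Y3 - Y)) with hV
  have e1 : U / s = - (V / t) := by
    field_simp at hr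
    rw [hU, hV]
    field_simp
    linear_combination hr
  have e2 : (U / s) ^ 2 + a ^ 2 * b ^ 2 * ((1 - X * X2 - Y * Y2) / s) ^ 2
      = b ^ 2 * X ^ 2 + a ^ 2 * Y ^ 2 := by
    have : U ^ 2 + a ^ 2 * b ^ 2 * (1 - X * X2 - Y * Y2) ^ 2
      = (b ^ 2 * X ^ 2 + a ^ 2 * Y ^ 2) * s ^ 2 := by
      have : 1 - X * X2 - Y * Y2 = -(X * (X2 - X) + Y * (Y2 - Y)) := by
        linear_combination -h1
      rw [this, hs2, hU]; ring
    field_simp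
    linear_combination this
  have e3 : (V / t) ^ 2 + a ^ 2 * b ^ 2 * ((1 - X * X3 - Y * Y3) / t) ^ 2
      = b ^ 2 * X ^ 2 + a ^ 2 * Y ^ 2 := by
    have : V ^ 2 + a ^ 2 * b ^ 2 * (1 - X * X3 - Y * Y3) ^ 2
      = (b ^ 2 * X ^ 2 + a ^ 2 * Y ^ 2) * t ^ 2 := by
      have : 1 - X * X3 - Y * Y3 = -(X * (X3 - X) + Y * (Y3 - Y)) := by
        linear_combination -h1
      rw [this, ht2, hV]; ring
    field_simp
    linear_combination this
  have hab : a ^ 2 * b ^ 2 ≠ 0 := by positivity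
  have e4 : ((1 - X * X2 - Y * Y2) / s) ^ 2 = ((1 - X * X3 - Y * Y3) / t) ^ 2 := by
    apply mul_left_cancel₀ hab
    rw [e1] at e2
    linear_combination e2 - e3
  exact (sq_eq_sq₀ (by positivity) (by positivity)).1 e4

lemma pair_rel (a b J s X Y U V : ℝ) (h1 : X ^ 2 + Y ^ 2 = 1) (h2 : U ^ 2 + V ^ 2 = 1)
    (hD : 0 < 1 - X * U - Y * V) (hJ : 1 - X * U - Y * V = J * s)
    (hs : s ^ 2 = a ^ 2 * (X - U) ^ 2 + b ^ 2 * (Y - V) ^ 2) :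
    (1 - J ^ 2 * (a ^ 2 - b ^ 2)) * (X * U) + (1 + J ^ 2 * (a ^ 2 - b ^ 2)) * (Y * V)
      = 1 - J ^ 2 * (a ^ 2 + b ^ 2) := by
  have k1 : (X - U) ^ 2 = (1 - X * U - Y * V) * (1 - (X * U - Y * V)) := by
    linear_combination (1 - U ^ 2) * h1 + (Y ^ 2) * h2
  have k2 : (Y - V) ^ 2 = (1 - X * U - Y * V) * (1 + (X * U - Y * V)) := by
    linear_combination (1 - V ^ 2) * h1 + (X ^ 2) * h2
  apply mul_left_cancel₀ hD.ne'
  rw [k1, k2] at hs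
  linear_combination (-(1 - X * U - Y * V) - J * s) * hJ - J ^ 2 * hs

/-- complex algebra -/
lemma cx_core (z1 z2 z3 μ κ : ℂ)
    (n12 : z1 ≠ z2) (n23 : z2 ≠ z3) (n13 : z1 ≠ z3)
    (F12 : z1 ^ 2 + z2 ^ 2 = κ * (z1 * z2) + μ * (z1 ^ 2 * z2 ^ 2 + 1))
    (F13 : z1 ^ 2 + z3 ^ 2 = κ * (z1 * z3) + μ * (z1 ^ 2 * z3 ^ 2 + 1))
    (F23 : z2 ^ 2 + z3 ^ 2 = κ * (z2 * z3) + μ * (z2 ^ 2 * z3 ^ 2 + 1)) :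
    z1 + z2 + z3 = - μ * (z1 * z2 * z3) ∧
    μ * (z1 * z2 + z2 * z3 + z1 * z3) = -(1 + κ) := by
  have s12 : z1 - z2 ≠ 0 := sub_ne_zero.2 n12
  have s23 : z2 - z3 ≠ 0 := sub_ne_zero.2 n23
  have s13 : z1 - z3 ≠ 0 := sub_ne_zero.2 n13
  have H1 : z2 * z3 - z1 ^ 2 - μ * z1 ^ 2 * (z2 * z3) + μ = 0 := by
    apply mul_left_cancel₀ s23
    linear_combination z3 * F12 - z2 * F13
  have H2 : z1 * z3 - z2 ^ 2 - μ * z2 ^ 2 * (z1 * z3) + μ = 0 := by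
    apply mul_left_cancel₀ s13
    linear_combination z3 * F12 - z1 * F23
  have G1 : (z2 + z3) * (1 - μ * z1 ^ 2) - κ * z1 = 0 := by
    apply mul_left_cancel₀ s23
    linear_combination F12 - F13
  have G2 : (z1 + z3) * (1 - μ * z2 ^ 2) - κ * z2 = 0 := by
    apply mul_left_cancel₀ s13
    linear_combination F12 - F23
  constructor
  · apply mul_left_cancel₀ s12
    linear_combination H2 - H1
  · apply mul_left_cancel₀ s12
    linear_combination G2 - G1

lemma core (X1 Y1 X2 Y2 X3 Y3 μ p : ℝ)
    (h1 : X1 ^ 2 + Y1 ^ 2 = 1) (h2 : X2 ^ 2 + Y2 ^ 2 = 1) (h3 : X3 ^ 2 + Y3 ^ 2 = 1)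
    (d12 : 0 < 1 - X1 * X2 - Y1 * Y2) (d13 : 0 < 1 - X1 * X3 - Y1 * Y3)
    (d23 : 0 < 1 - X2 * X3 - Y2 * Y3) (hμ : 0 < μ)
    (F12 : (1 - μ) * (X1 * X2) + (1 + μ) * (Y1 * Y2) = 1 - p)
    (F13 : (1 - μ) * (X1 * X3) + (1 + μ) * (Y1 * Y3) = 1 - p)
    (F23 : (1 - μ) * (X2 * X3) + (1 + μ) * (Y2 * Y3) = 1 - p) :
    μ ^ 2 = 3 - 2 * p ∧ ∃ K S d : ℝ, K ^ 2 + S ^ 2 = 1 ∧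
      d = (X2 - X1) * (Y3 - Y1) - (Y2 - Y1) * (X3 - X1) ∧
      4 * d ^ 2 = 27 - 18 * μ ^ 2 - μ ^ 4 - 8 * μ ^ 3 * (K ^ 2 - S ^ 2) ∧
      2 * ((1 - X1 * X2 - Y1 * Y2) * (1 - X1 * X3 - Y1 * Y3) * (1 - X2 * X3 - Y2 * Y3))
        = d ^ 2 ∧
      (1 - X1 * X2 - Y1 * Y2) + (1 - X1 * X3 - Y1 * Y3) + (1 - X2 * X3 - Y2 * Y3)
        = (9 - μ ^ 2) / 2 ∧
      ((⟨X1, Y1⟩ : ℂ) * ⟨X2, Y2⟩ * ⟨X3, Y3⟩ = ⟨K, S⟩) ∧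
      (∀ z : ℂ, (z - ⟨X1, Y1⟩) * (z - ⟨X2, Y2⟩) * (z - ⟨X3, Y3⟩) =
        z ^ 3 + μ * ⟨K, S⟩ * z ^ 2 - μ * z - ⟨K, S⟩) := by
  have key : ∀ X Y : ℝ, X ^ 2 + Y ^ 2 = 1 → (⟨X, Y⟩ : ℂ) * ⟨X, -Y⟩ = 1 := by
    intro X Y h
    apply Complex.ext <;> simp <;> linarith
  obtain ⟨z1, hz1⟩ : ∃ z : ℂ, z = ⟨X1, Y1⟩ := ⟨_, rfl⟩
  obtain ⟨z2, hz2⟩ : ∃ z : ℂ, z = ⟨X2, Y2⟩ := ⟨_, rfl⟩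
  obtain ⟨z3, hz3⟩ : ∃ z : ℂ, z = ⟨X3, Y3⟩ := ⟨_, rfl⟩
  obtain ⟨w1, hw1⟩ : ∃ z : ℂ, z = ⟨X1, -Y1⟩ := ⟨_, rfl⟩
  obtain ⟨w2, hw2⟩ : ∃ z : ℂ, z = ⟨X2, -Y2⟩ := ⟨_, rfl⟩
  obtain ⟨w3, hw3⟩ : ∃ z : ℂ, z = ⟨X3, -Y3⟩ := ⟨_, rfl⟩
  have u1 : z1 * w1 = 1 := by rw [hz1, hw1]; exact key _ _ h1
  have u2 : z2 * w2 = 1 := by rw [hz2, hw2]; exact key _ _ h2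
  have u3 : z3 * w3 = 1 := by rw [hz3, hw3]; exact key _ _ h3
  have n1 : z1 ≠ 0 := left_ne_zero_of_mul_eq_one u1
  have n2 : z2 ≠ 0 := left_ne_zero_of_mul_eq_one u2
  have n3 : z3 ≠ 0 := left_ne_zero_of_mul_eq_one u3
  have ne : ∀ X Y U V : ℝ, X ^ 2 + Y ^ 2 = 1 → 0 < 1 - X * U - Y * V →
      (⟨X, Y⟩ : ℂ) ≠ ⟨U, V⟩ := by
    intro X Y U V h h' e
    obtain ⟨e1, e2⟩ := Complex.mk.inj e
    subst e1 e2
    nlinarith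
  have n12 : z1 ≠ z2 := by rw [hz1, hz2]; exact ne _ _ _ _ h1 d12
  have n13 : z1 ≠ z3 := by rw [hz1, hz3]; exact ne _ _ _ _ h1 d13
  have n23 : z2 ≠ z3 := by rw [hz2, hz3]; exact ne _ _ _ _ h2 d23
  have Fc : ∀ X Y U V : ℝ, X ^ 2 + Y ^ 2 = 1 → U ^ 2 + V ^ 2 = 1 →
      (1 - μ) * (X * U) + (1 + μ) * (Y * V) = 1 - p → ∀ z w : ℂ, z = ⟨X, Y⟩ → w = ⟨U, V⟩ →
      z ^ 2 + w ^ 2 = ((2 - 2 * p : ℝ) : ℂ) * (z * w) + μ * (z ^ 2 * w ^ 2 + 1) := by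
    intro X Y U V h h' e z w hz hw
    have t1 := key _ _ h
    have t2 := key _ _ h'
    rw [← hz] at t1
    rw [← hw] at t2
    have t3 : z * ⟨U, -V⟩ + w * ⟨X, -Y⟩ = ((2 - 2 * p : ℝ) : ℂ) +
        μ * (z * w + ⟨X, -Y⟩ * ⟨U, -V⟩) := by
      rw [hz, hw]
      apply Complex.ext <;> simp <;> linarith
    linear_combination (z * w) * t3 + (-w ^ 2 + μ * w * ⟨U, -V⟩) * t1 + (-z ^ 2 + μ) * t2
  have E := cx_core z1 z2 z3 μ _ n12 n23 n13
    (Fc _ _ _ _ h1 h2 F12 _ _ hz1 hz2) (Fc _ _ _ _ h1 h3 F13 _ _ hz1 hz3)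
    (Fc _ _ _ _ h2 h3 F23 _ _ hz2 hz3)
  obtain ⟨E1, E2⟩ := E
  have E1c : w1 + w2 + w3 = - μ * (w1 * w2 * w3) := by
    have := congrArg (starRingEnd ℂ) E1
    simp only [map_add, map_mul, map_neg, Complex.conj_ofReal] at this
    have c : ∀ X Y : ℝ, (starRingEnd ℂ) ⟨X, Y⟩ = ⟨X, -Y⟩ := by
      intro X Y; apply Complex.ext <;> simp
    rw [hz1, hz2, hz3, c, c, c] at this
    rw [hw1, hw2, hw3]; exact this
  have v1 : w1 = z1⁻¹ := eq_inv_of_mul_eq_one_right u1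
  have v2 : w2 = z2⁻¹ := eq_inv_of_mul_eq_one_right u2
  have v3 : w3 = z3⁻¹ := eq_inv_of_mul_eq_one_right u3
  have E3 : z1 * z2 + z2 * z3 + z1 * z3 = - μ := by
    rw [v1, v2, v3] at E1c
    field_simp at E1c
    linear_combination E1c
  have hp : μ ^ 2 = 3 - 2 * p := by
    rw [E3] at E2
    have : ((μ ^ 2 : ℝ) : ℂ) = ((3 - 2 * p : ℝ) : ℂ) := by
      push_cast at E2 ⊢
      linear_combination -E2
    exact_mod_cast this
  refine ⟨hp, (z1 * z2 * z3).re, (z1 * z2 * z3).im, _, ?_, rfl, ?_, ?_, ?_, ?_, ?_⟩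
  · rw [hz1, hz2, hz3]
    simp
    have : ∀ A B : ℝ, A ^ 2 + B ^ 2 = A ^ 2 + B ^ 2 := fun _ _ => rfl
    calc _ = (X1 ^ 2 + Y1 ^ 2) * (X2 ^ 2 + Y2 ^ 2) * (X3 ^ 2 + Y3 ^ 2) := by ring
      _ = 1 := by rw [h1, h2, h3]; ring
  · have hd : (2 * Complex.I * (((X2 - X1) * (Y3 - Y1) - (Y2 - Y1) * (X3 - X1) : ℝ) : ℂ))
        = (w2 - w1) * (z3 - z1) - (z2 - z1) * (w3 - w1) := by
      rw [hz1, hz2, hz3, hw1, hw2, hw3]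
      apply Complex.ext <;> simp <;> ring
    have hks : ((2 * ((z1 * z2 * z3).re ^ 2 - (z1 * z2 * z3).im ^ 2) : ℝ) : ℂ)
        = (z1 * z2 * z3) ^ 2 + (w1 * w2 * w3) ^ 2 := by
      rw [hz1, hz2, hz3, hw1, hw2, hw3]
      apply Complex.ext <;> simp [pow_two] <;> ring
    have hV : ((w2 - w1) * (z3 - z1) - (z2 - z1) * (w3 - w1)) * (z1 * z2 * z3)
        = -((z1 - z2) * (z2 - z3) * (z3 - z1)) := by
      rw [v1, v2, v3]; field_simp; ring
    have hdisc : ((z1 - z2) * (z2 - z3) * (z3 - z1)) ^ 2 =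
        (z1 + z2 + z3) ^ 2 * (z1 * z2 + z2 * z3 + z1 * z3) ^ 2
        - 4 * (z1 * z2 + z2 * z3 + z1 * z3) ^ 3 - 4 * (z1 + z2 + z3) ^ 3 * (z1 * z2 * z3)
        + 18 * (z1 + z2 + z3) * (z1 * z2 + z2 * z3 + z1 * z3) * (z1 * z2 * z3)
        - 27 * (z1 * z2 * z3) ^ 2 := by ring
    rw [← neg_sq, E1, E3, ← hV, ← hd] at hdisc
    have hww : (z1 * z2 * z3) * (w1 * w2 * w3) = 1 := by
      linear_combination z2 * w2 * z3 * w3 * u1 + z3 * w3 * u2 + u3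
    set w := z1 * z2 * z3 with hw
    set v := w1 * w2 * w3 with hv
    have hwn : w ≠ 0 := left_ne_zero_of_mul_eq_one hww
    have fin : ((4 * ((X2 - X1) * (Y3 - Y1) - (Y2 - Y1) * (X3 - X1)) ^ 2 : ℝ) : ℂ) =
       ((27 - 18 * μ ^ 2 - μ ^ 4 - 4 * μ ^ 3 * (2 * (w.re ^ 2 - w.im ^ 2)) : ℝ) : ℂ) := by
      apply mul_left_cancel₀ (pow_ne_zero 2 hwn)
      rw [Complex.ofReal_sub _ (4 * μ ^ 3 * _), Complex.ofReal_mul (4 * μ ^ 3), hks]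
      push_cast at hdisc ⊢
      have I2 := Complex.I_sq
      generalize ((X2 - X1) * (Y3 - Y1) - (Y2 - Y1) * (X3 - X1) : ℂ) = D at *
      linear_combination -hdisc + 4 * D ^ 2 * w ^ 2 * I2 + 4 * μ ^ 3 * (w * v + 1) * hww
    have fin' := Complex.ofReal_injective fin
    linear_combination fin'
  · have id : ∀ X Y U V : ℝ, X ^ 2 + Y ^ 2 = 1 → U ^ 2 + V ^ 2 = 1 →
        ((2 * (1 - X * U - Y * V) : ℝ) : ℂ) = ((⟨X, Y⟩ : ℂ) - ⟨U, V⟩) * (⟨X, -Y⟩ - ⟨U, -V⟩) := by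
      intro X Y U V h h'
      apply Complex.ext <;> simp
      · linarith
      · ring
    have i1 := id _ _ _ _ h1 h2
    have i2 := id _ _ _ _ h1 h3
    have i3 := id _ _ _ _ h2 h3
    have hd : (2 * Complex.I * (((X2 - X1) * (Y3 - Y1) - (Y2 - Y1) * (X3 - X1) : ℝ) : ℂ))
        = (w2 - w1) * (z3 - z1) - (z2 - z1) * (w3 - w1) := by
      rw [hz1, hz2, hz3, hw1, hw2, hw3]
      apply Complex.ext <;> simp <;> ring
    rw [← hz1, ← hz2, ← hw1, ← hw2] at i1
    rw [← hz1, ← hz3, ← hw1, ← hw3] at i2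
    rw [← hz2, ← hz3, ← hw2, ← hw3] at i3
    have hV : (z1 - z2) * (w1 - w2) * ((z1 - z3) * (w1 - w3)) * ((z2 - z3) * (w2 - w3))
       = - ((w2 - w1) * (z3 - z1) - (z2 - z1) * (w3 - w1)) ^ 2 := by
      rw [v1, v2, v3]; field_simp; ring
    rw [← i1, ← i2, ← i3, ← hd] at hV
    have : ((2 * (1 - X1 * X2 - Y1 * Y2) * (2 * (1 - X1 * X3 - Y1 * Y3)) *
      (2 * (1 - X2 * X3 - Y2 * Y3)) : ℝ) : ℂ) =
      ((4 * ((X2 - X1) * (Y3 - Y1) - (Y2 - Y1) * (X3 - X1)) ^ 2 : ℝ) : ℂ) := by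
      have I2 := Complex.I_sq
      push_cast at hV ⊢
      rw [hV, mul_pow, mul_pow, I2]; ring
    have := Complex.ofReal_injective this
    linear_combination this / 4
  · have : (z1 + z2 + z3) * (w1 + w2 + w3) = ((μ ^ 2 : ℝ) : ℂ) := by
      rw [E1, E1c]
      push_cast
      linear_combination (μ : ℂ) ^ 2 * (z2 * w2 * z3 * w3 * u1 + z3 * w3 * u2 + u3)
    rw [hz1, hz2, hz3, hw1, hw2, hw3] at this
    have := congrArg Complex.re this
    simp [- Complex.ofReal_pow] at this
    linarith
  · rw [← hz1, ← hz2, ← hz3]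
  · intro z
    have : (⟨(z1 * z2 * z3).re, (z1 * z2 * z3).im⟩ : ℂ) = z1 * z2 * z3 := rfl
    rw [this, ← hz1, ← hz2, ← hz3]
    linear_combination (-z ^ 2) * E1 + z * E3

lemma vertex_iff (X1 Y1 X2 Y2 X3 Y3 μ K S : ℝ) (hμ0 : 0 < μ) (hμ : μ < 1)
    (hKS : K ^ 2 + S ^ 2 = 1)
    (hz : ∀ z : ℂ, (z - ⟨X1, Y1⟩) * (z - ⟨X2, Y2⟩) * (z - ⟨X3, Y3⟩) =
        z ^ 3 + μ * ⟨K, S⟩ * z ^ 2 - μ * z - ⟨K, S⟩) :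
    (S = 0 ↔ (((X1 = 1 ∨ X1 = -1) ∧ Y1 = 0) ∨ ((X2 = 1 ∨ X2 = -1) ∧ Y2 = 0) ∨
      ((X3 = 1 ∨ X3 = -1) ∧ Y3 = 0))) ∧
    (K = 0 ↔ ((X1 = 0 ∧ (Y1 = 1 ∨ Y1 = -1)) ∨ (X2 = 0 ∧ (Y2 = 1 ∨ Y2 = -1)) ∨
      (X3 = 0 ∧ (Y3 = 1 ∨ Y3 = -1)))) := by
  have root : ∀ z : ℂ, z ^ 3 + μ * ⟨K, S⟩ * z ^ 2 - μ * z - ⟨K, S⟩ = 0 ↔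
      z = ⟨X1, Y1⟩ ∨ z = ⟨X2, Y2⟩ ∨ z = ⟨X3, Y3⟩ := by
    intro z
    rw [← hz, mul_eq_zero, mul_eq_zero, sub_eq_zero, sub_eq_zero, sub_eq_zero, or_assoc]
  have hm : (1 - μ : ℂ) ≠ 0 := by
    exact_mod_cast (by linarith : (1 - μ) ≠ 0)
  have hp : (1 + μ : ℂ) ≠ 0 := by
    exact_mod_cast (by linarith : (1 + μ) ≠ 0)
  have q1 : (1 : ℂ) = ⟨K, S⟩ ↔ (1 : ℂ) = ⟨X1, Y1⟩ ∨ (1 : ℂ) = ⟨X2, Y2⟩ ∨ (1 : ℂ) = ⟨X3, Y3⟩ := by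
    rw [← root]
    constructor
    · intro h; rw [← h]; ring
    · intro h; apply mul_left_cancel₀ hm; linear_combination h
  have q2 : (-1 : ℂ) = ⟨K, S⟩ ↔
      (-1 : ℂ) = ⟨X1, Y1⟩ ∨ (-1 : ℂ) = ⟨X2, Y2⟩ ∨ (-1 : ℂ) = ⟨X3, Y3⟩ := by
    rw [← root]
    constructor
    · intro h; rw [← h]; ring
    · intro h; apply mul_left_cancel₀ hm; linear_combination h
  have I2 := Complex.I_sq
  have I3 : Complex.I ^ 3 = - Complex.I := by rw [pow_succ, I2]; ring
  have q3 : (-Complex.I : ℂ) = ⟨K, S⟩ ↔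
      Complex.I = ⟨X1, Y1⟩ ∨ Complex.I = ⟨X2, Y2⟩ ∨ Complex.I = ⟨X3, Y3⟩ := by
    rw [← root, I3, I2]
    constructor
    · intro h; rw [← h]; ring
    · intro h; apply mul_left_cancel₀ hp; linear_combination h
  have q4 : (Complex.I : ℂ) = ⟨K, S⟩ ↔
      -Complex.I = ⟨X1, Y1⟩ ∨ -Complex.I = ⟨X2, Y2⟩ ∨ -Complex.I = ⟨X3, Y3⟩ := by
    rw [← root, neg_sq, I2, Odd.neg_pow (by decide), I3]
    constructor
    · intro h; rw [← h]; ring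
    · intro h; apply mul_left_cancel₀ hp; linear_combination h
  simp only [Complex.ext_iff, Complex.one_re, Complex.one_im, Complex.neg_re, Complex.neg_im,
    Complex.I_re, Complex.I_im, neg_zero] at q1 q2 q3 q4
  have r1 : S = 0 ↔ (1 = K ∧ 0 = S) ∨ (-1 = K ∧ 0 = S) := by
    constructor
    · rintro rfl
      have : K ^ 2 = 1 := by linarith
      rcases sq_eq_one_iff_or K this with h | h
      · left; exact ⟨h.symm, rfl⟩
      · right; exact ⟨h.symm, rfl⟩
    · rintro (h | h) <;> exact h.2.symm
  have r2 : K = 0 ↔ (0 = K ∧ -1 = S) ∨ (0 = K ∧ 1 = S) := by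
    constructor
    · rintro rfl
      have : S ^ 2 = 1 := by linarith
      rcases sq_eq_one_iff_or S this with h | h
      · right; exact ⟨rfl, h.symm⟩
      · left; exact ⟨rfl, h.symm⟩
    · rintro (h | h) <;> exact h.1.symm
  constructor
  · rw [r1, q1, q2]
    simp only [eq_comm (a := (1 : ℝ)), eq_comm (a := (-1 : ℝ)), eq_comm (a := (0 : ℝ))]
    grind
  · rw [r2, q3, q4]
    simp only [eq_comm (a := (1 : ℝ)), eq_comm (a := (-1 : ℝ)), eq_comm (a := (0 : ℝ))]
    grind

lemma norm_sq_pt (P Q : Pt) : ‖P - Q‖ ^ 2 = (P 0 - Q 0) ^ 2 + (P 1 - Q 1) ^ 2 := by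
  rw [EuclideanSpace.norm_sq_eq]
  simp [Fin.sum_univ_two]

lemma D_pos (X Y U V : ℝ) (h1 : X ^ 2 + Y ^ 2 = 1) (h2 : U ^ 2 + V ^ 2 = 1)
    (h : ¬ (X = U ∧ Y = V)) : 0 < 1 - X * U - Y * V := by
  have e : 2 * (1 - X * U - Y * V) = (X - U) ^ 2 + (Y - V) ^ 2 := by
    linear_combination -h1 - h2
  by_contra hn
  have k1 : (X - U) ^ 2 = 0 := by nlinarith [sq_nonneg (X - U), sq_nonneg (Y - V)]
  have k2 : (Y - V) ^ 2 = 0 := by nlinarith [sq_nonneg (X - U), sq_nonneg (Y - V)]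
  exact h ⟨by linarith [pow_eq_zero_iff (two_ne_zero) |>.1 k1],
    by linarith [pow_eq_zero_iff (two_ne_zero) |>.1 k2]⟩

lemma scale_bounds (k d m M e f v : ℝ) (hk : 0 < k) (hd : 0 < d) (hm : 0 < m) (hM : 0 < M)
    (hv : 0 < v) (h1 : d ^ 2 = m ^ 2 + v * e ^ 2) (h2 : d ^ 2 = M ^ 2 - v * f ^ 2) :
    k * m ≤ k * d ∧ k * d ≤ k * M ∧ (k * d = k * m ↔ e = 0) ∧ (k * d = k * M ↔ f = 0) := by
  have i1 : m ≤ d := by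
    apply le_of_sq_le_sq _ hd.le
    nlinarith [mul_nonneg hv.le (sq_nonneg e)]
  have i2 : d ≤ M := by
    apply le_of_sq_le_sq _ hM.le
    nlinarith [mul_nonneg hv.le (sq_nonneg f)]
  refine ⟨by gcongr, by gcongr, ?_, ?_⟩
  · constructor
    · intro h
      have := mul_left_cancel₀ hk.ne' h
      rw [this] at h1
      have : v * e ^ 2 = 0 := by linarith
      simpa [hv.ne'] using this
    · rintro rfl
      have : d ^ 2 = m ^ 2 := by linarith
      rw [(sq_eq_sq₀ hd.le hm.le).1 this]
  · constructor
    · intro h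
      have := mul_left_cancel₀ hk.ne' h
      rw [this] at h2
      have : v * f ^ 2 = 0 := by linarith
      simpa [hv.ne'] using this
    · rintro rfl
      have : d ^ 2 = M ^ 2 := by linarith
      rw [(sq_eq_sq₀ hd.le hM.le).1 this]

lemma consts (a b J μ : ℝ) (ha : 0 < a) (hb : 0 < b) (hab : b < a) (hJ : 0 < J)
    (hμ0 : 0 < μ) (hμ : μ < 1)
    (ka : 4 * J ^ 2 * a ^ 2 = (1 + μ) * (3 - μ)) (kb : 4 * J ^ 2 * b ^ 2 = (1 - μ) * (3 + μ)) :
    let δ := Real.sqrt (a ^ 4 - a ^ 2 * b ^ 2 + b ^ 4)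
    b ^ 2 * (δ - b ^ 2) / ((a ^ 2 - b ^ 2) * a) = (2 * a * b * J / (9 - μ ^ 2)) * ((3 + μ) * b * J) ∧
    a ^ 2 * (a ^ 2 - δ) / ((a ^ 2 - b ^ 2) * b) = (2 * a * b * J / (9 - μ ^ 2)) * ((3 - μ) * a * J) ∧
    (a ^ 2 + δ) / (2 * a) = (1 / (4 * a * b * J ^ 3)) * ((3 + μ) * b * J) ∧
    (b ^ 2 + δ) / (2 * b) = (1 / (4 * a * b * J ^ 3)) * ((3 - μ) * a * J) := by
  intro δ
  have hδ : δ = (3 + μ ^ 2) / (4 * J ^ 2) := by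
    have : a ^ 4 - a ^ 2 * b ^ 2 + b ^ 4 = ((3 + μ ^ 2) / (4 * J ^ 2)) ^ 2 := by
      have ea : a ^ 2 = (1 + μ) * (3 - μ) / (4 * J ^ 2) := by field_simp; linear_combination ka
      have eb : b ^ 2 = (1 - μ) * (3 + μ) / (4 * J ^ 2) := by field_simp; linear_combination kb
      rw [show a ^ 4 = (a ^ 2) ^ 2 by ring, show b ^ 4 = (b ^ 2) ^ 2 by ring, ea, eb]
      field_simp
      ring
    show Real.sqrt _ = _
    rw [this, Real.sqrt_sq (by positivity)]
  have h4 : 4 * J ^ 2 * δ = 3 + μ ^ 2 := by rw [hδ]; field_simp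
  have hc : 4 * J ^ 2 * (a ^ 2 - b ^ 2) = 4 * μ := by linear_combination ka - kb
  have hJ2 : 4 * J ^ 2 ≠ 0 := by positivity
  have hcp : 0 < a ^ 2 - b ^ 2 := by
    have : 0 < (a - b) * (a + b) := mul_pos (by linarith) (by linarith)
    linarith
  have h9 : 9 - μ ^ 2 = (3 - μ) * (3 + μ) := by ring
  have m1 : 0 < 3 - μ := by linarith
  have m2 : 0 < 3 + μ := by linarith
  have c1 : (δ - b ^ 2) = (a ^ 2 - b ^ 2) * (1 + μ) / 2 := by
    apply mul_left_cancel₀ hJ2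
    linear_combination h4 - kb - (1 + μ) / 2 * hc
  have c2 : (a ^ 2 - δ) = (a ^ 2 - b ^ 2) * (1 - μ) / 2 := by
    apply mul_left_cancel₀ hJ2
    linear_combination -h4 + ka - (1 - μ) / 2 * hc
  have c3 : a ^ 2 + δ = (3 + μ) / (2 * J ^ 2) := by
    apply mul_left_cancel₀ hJ2
    field_simp
    linear_combination (h4 + ka) / 2
  have c4 : b ^ 2 + δ = (3 - μ) / (2 * J ^ 2) := by
    apply mul_left_cancel₀ hJ2
    field_simp
    linear_combination (h4 + kb) / 2
  rw [c1, c2, c3, c4, h9]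
  refine ⟨?_, ?_, ?_, ?_⟩
  · field_simp
    linear_combination -ka
  · field_simp
    linear_combination -kb
  · field_simp
    norm_num
  · field_simp
    norm_num

set_option maxHeartbeats 2000000 in
/-- Bounds on the inradius and circumradius over the 3-periodic family, with the
extremes attained exactly at the isosceles orbits having a vertex at (±a, 0)
(minima) or at (0, ±b) (maxima). -/
theorem radii_bounds (a b : ℝ) (hb : 0 < b) (hab : b < a)
    (P₁ P₂ P₃ : Pt) (h : IsOrbit a b P₁ P₂ P₃) :
    let s₁ := ‖P₃ - P₂‖
    let s₂ := ‖P₁ - P₃‖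
    let s₃ := ‖P₂ - P₁‖
    let L := s₁ + s₂ + s₃
    let A := |((P₂ - P₁) 0) * ((P₃ - P₁) 1) - ((P₂ - P₁) 1) * ((P₃ - P₁) 0)| / 2
    let r := 2 * A / L
    let R := s₁ * s₂ * s₃ / (4 * A)
    let δ := Real.sqrt (a ^ 4 - a ^ 2 * b ^ 2 + b ^ 4)
    let rmin := b ^ 2 * (δ - b ^ 2) / ((a ^ 2 - b ^ 2) * a)
    let rmax := a ^ 2 * (a ^ 2 - δ) / ((a ^ 2 - b ^ 2) * b)
    let Rmin := (a ^ 2 + δ) / (2 * a)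
    let Rmax := (b ^ 2 + δ) / (2 * b)
    let horiz : Prop :=
      ((P₁ 0 = a ∨ P₁ 0 = -a) ∧ P₁ 1 = 0) ∨ ((P₂ 0 = a ∨ P₂ 0 = -a) ∧ P₂ 1 = 0) ∨
        ((P₃ 0 = a ∨ P₃ 0 = -a) ∧ P₃ 1 = 0)
    let vert : Prop :=
      (P₁ 0 = 0 ∧ (P₁ 1 = b ∨ P₁ 1 = -b)) ∨ (P₂ 0 = 0 ∧ (P₂ 1 = b ∨ P₂ 1 = -b)) ∨
        (P₃ 0 = 0 ∧ (P₃ 1 = b ∨ P₃ 1 = -b))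
    (rmin ≤ r ∧ r ≤ rmax ∧ Rmin ≤ R ∧ R ≤ Rmax) ∧
      (r = rmin ↔ horiz) ∧ (R = Rmin ↔ horiz) ∧
      (r = rmax ↔ vert) ∧ (R = Rmax ↔ vert) := by
  obtain ⟨n12, n23, n13, o1, o2, o3, r1, r2, r3⟩ := h
  intro s₁ s₂ s₃ L A r R δ rmin rmax Rmin Rmax horiz vert
  have ha : 0 < a := hb.trans hab
  obtain ⟨X1, hX1⟩ : ∃ X, P₁ 0 = a * X := ⟨P₁ 0 / a, by field_simp⟩
  obtain ⟨X2, hX2⟩ : ∃ X, P₂ 0 = a * X := ⟨P₂ 0 / a, by field_simp⟩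
  obtain ⟨X3, hX3⟩ : ∃ X, P₃ 0 = a * X := ⟨P₃ 0 / a, by field_simp⟩
  obtain ⟨Y1, hY1⟩ : ∃ X, P₁ 1 = b * X := ⟨P₁ 1 / b, by field_simp⟩
  obtain ⟨Y2, hY2⟩ : ∃ X, P₂ 1 = b * X := ⟨P₂ 1 / b, by field_simp⟩
  obtain ⟨Y3, hY3⟩ : ∃ X, P₃ 1 = b * X := ⟨P₃ 1 / b, by field_simp⟩
  have h1 : X1 ^ 2 + Y1 ^ 2 = 1 := by
    unfold onEllipse at o1; rw [hX1, hY1] at o1; field_simp at o1; exact o1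
  have h2 : X2 ^ 2 + Y2 ^ 2 = 1 := by
    unfold onEllipse at o2; rw [hX2, hY2] at o2; field_simp at o2; exact o2
  have h3 : X3 ^ 2 + Y3 ^ 2 = 1 := by
    unfold onEllipse at o3; rw [hX3, hY3] at o3; field_simp at o3; exact o3
  have ext2 : ∀ P Q : Pt, P 0 = Q 0 → P 1 = Q 1 → P = Q := by
    intro P Q e f
    ext i
    fin_cases i
    · exact e
    · exact f
  have d12 : 0 < 1 - X1 * X2 - Y1 * Y2 := D_pos _ _ _ _ h1 h2 (by
    rintro ⟨e, f⟩; exact n12 (ext2 _ _ (by rw [hX1, hX2, e]) (by rw [hY1, hY2, f])))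
  have d13 : 0 < 1 - X1 * X3 - Y1 * Y3 := D_pos _ _ _ _ h1 h3 (by
    rintro ⟨e, f⟩; exact n13 (ext2 _ _ (by rw [hX1, hX3, e]) (by rw [hY1, hY3, f])))
  have d23 : 0 < 1 - X2 * X3 - Y2 * Y3 := D_pos _ _ _ _ h2 h3 (by
    rintro ⟨e, f⟩; exact n23 (ext2 _ _ (by rw [hX2, hX3, e]) (by rw [hY2, hY3, f])))
  have p1 : 0 < s₁ := norm_pos_iff.2 (sub_ne_zero.2 n23.symm)
  have p2 : 0 < s₂ := norm_pos_iff.2 (sub_ne_zero.2 n13)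
  have p3 : 0 < s₃ := norm_pos_iff.2 (sub_ne_zero.2 n12.symm)
  have q1 : s₁ ^ 2 = a ^ 2 * (X3 - X2) ^ 2 + b ^ 2 * (Y3 - Y2) ^ 2 := by
    show ‖P₃ - P₂‖ ^ 2 = _
    rw [norm_sq_pt, hX3, hX2, hY3, hY2]; ring
  have q2 : s₂ ^ 2 = a ^ 2 * (X1 - X3) ^ 2 + b ^ 2 * (Y1 - Y3) ^ 2 := by
    show ‖P₁ - P₃‖ ^ 2 = _
    rw [norm_sq_pt, hX3, hX1, hY3, hY1]; ring
  have q3 : s₃ ^ 2 = a ^ 2 * (X2 - X1) ^ 2 + b ^ 2 * (Y2 - Y1) ^ 2 := by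
    show ‖P₂ - P₁‖ ^ 2 = _
    rw [norm_sq_pt, hX2, hX1, hY2, hY1]; ring
  unfold reflects at r1 r2
  simp only [PiLp.add_apply, PiLp.smul_apply, PiLp.sub_apply, smul_eq_mul,
    norm_sub_rev P₃ P₁, norm_sub_rev P₁ P₂, hX1, hX2, hX3, hY1, hY2, hY3] at r1 r2
  have J1 := refl_core a b X1 Y1 X2 Y2 X3 Y3 s₃ s₂ ha hb h1 d12 d13 p3 p2 q3
    (by rw [q2]; ring) r1
  have J2 := refl_core a b X2 Y2 X3 Y3 X1 Y1 s₁ s₃ ha hb h2 d23 (by linarith) p1 p3 q1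
    (by rw [q3]; ring) r2
  obtain ⟨J, hJ⟩ : ∃ J, J = (1 - X1 * X2 - Y1 * Y2) / s₃ := ⟨_, rfl⟩
  have hJ0 : 0 < J := by rw [hJ]; positivity
  have g3 : 1 - X1 * X2 - Y1 * Y2 = J * s₃ := by rw [hJ]; field_simp
  have g2 : 1 - X1 * X3 - Y1 * Y3 = J * s₂ := by rw [hJ, J1]; field_simp
  have g1 : 1 - X2 * X3 - Y2 * Y3 = J * s₁ := by
    have : J = (1 - X2 * X3 - Y2 * Y3) / s₁ := by
      rw [J2, hJ]; ring
    rw [this]; field_simp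
  have F12 := pair_rel a b J s₃ X1 Y1 X2 Y2 h1 h2 d12 g3 (by rw [q3]; ring)
  have F13 := pair_rel a b J s₂ X1 Y1 X3 Y3 h1 h3 d13 g2 (by rw [q2])
  have F23 := pair_rel a b J s₁ X2 Y2 X3 Y3 h2 h3 d23 g1 (by rw [q1]; ring)
  have hcp : 0 < a ^ 2 - b ^ 2 := by
    have : 0 < (a - b) * (a + b) := mul_pos (by linarith) (by linarith)
    linarith
  obtain ⟨μ, hμ⟩ : ∃ μ, μ = J ^ 2 * (a ^ 2 - b ^ 2) := ⟨_, rfl⟩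
  have hμ0 : 0 < μ := by rw [hμ]; positivity
  rw [← hμ] at F12 F13 F23
  obtain ⟨hp, K, S, d, hKS, hd, hdisc, hprod, hsum, -, hz⟩ :=
    core X1 Y1 X2 Y2 X3 Y3 μ _ h1 h2 h3 d12 d13 d23 hμ0 F12 F13 F23
  have ka : 4 * J ^ 2 * a ^ 2 = (1 + μ) * (3 - μ) := by
    linear_combination -2 * hμ + hp
  have kb : 4 * J ^ 2 * b ^ 2 = (1 - μ) * (3 + μ) := by
    linear_combination 2 * hμ + hp
  have hμ1 : μ < 1 := by
    have : 0 < (1 - μ) * (3 + μ) := by rw [← kb]; positivity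
    have := (pos_iff_pos_of_mul_pos this).2 (by linarith)
    linarith
  obtain ⟨V1, V2⟩ := vertex_iff X1 Y1 X2 Y2 X3 Y3 μ K S hμ0 hμ1 hKS hz
  have hd0 : 0 < |d| := by
    rw [abs_pos]
    rintro rfl
    have : 0 < (1 - X1 * X2 - Y1 * Y2) * (1 - X1 * X3 - Y1 * Y3) * (1 - X2 * X3 - Y2 * Y3) := by
      positivity
    linarith
  have hA : A = a * b * |d| / 2 := by
    show |_| / 2 = _
    rw [← abs_of_pos (mul_pos ha hb), ← abs_mul, hd]
    simp only [PiLp.sub_apply, hX1, hX2, hX3, hY1, hY2, hY3]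
    congr 2; ring
  have hL : L = (9 - μ ^ 2) / (2 * J) := by
    show s₁ + s₂ + s₃ = _
    rw [g1, g2, g3] at hsum
    field_simp
    linear_combination 2 * hsum
  have h9 : 0 < 9 - μ ^ 2 := by
    have : 0 < (3 - μ) * (3 + μ) := mul_pos (by linarith) (by linarith)
    linarith
  have hr : r = (2 * a * b * J / (9 - μ ^ 2)) * |d| := by
    show 2 * A / L = _
    rw [hA, hL]; field_simp
  have hR : R = (1 / (4 * a * b * J ^ 3)) * |d| := by
    show s₁ * s₂ * s₃ / (4 * A) = _
    rw [hA]
    rw [g1, g2, g3, ← sq_abs d] at hprod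
    field_simp
    linear_combination hprod
  have B1 : |d| ^ 2 = ((3 + μ) * b * J) ^ 2 + (4 * μ ^ 3) * S ^ 2 := by
    rw [sq_abs]
    linear_combination hdisc / 4 - (3 + μ) ^ 2 / 4 * kb - 2 * μ ^ 3 * hKS
  have B2 : |d| ^ 2 = ((3 - μ) * a * J) ^ 2 - (4 * μ ^ 3) * K ^ 2 := by
    rw [sq_abs]
    linear_combination hdisc / 4 - (3 - μ) ^ 2 / 4 * ka + 2 * μ ^ 3 * hKS
  obtain ⟨C1, C2, C3, C4⟩ := consts a b J μ ha hb hab hJ0 hμ0 hμ1 ka kb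
  have m1 : 0 < 3 - μ := by linarith
  have m2 : 0 < 3 + μ := by linarith
  have T1 := scale_bounds (2 * a * b * J / (9 - μ ^ 2)) |d| ((3 + μ) * b * J) ((3 - μ) * a * J) S K
    (4 * μ ^ 3) (by positivity) hd0 (by positivity) (by positivity) (by positivity) B1 B2
  have T2 := scale_bounds (1 / (4 * a * b * J ^ 3)) |d| ((3 + μ) * b * J) ((3 - μ) * a * J) S K
    (4 * μ ^ 3) (by positivity) hd0 (by positivity) (by positivity) (by positivity) B1 B2
  rw [← hr, ← C1, ← C2] at T1
  rw [← hR, ← C3, ← C4] at T2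
  have ex : ∀ X : ℝ, a * X = a ↔ X = 1 := fun X => by simp [ha.ne']
  have ex' : ∀ X : ℝ, a * X = -a ↔ X = -1 := fun X => by
    rw [← mul_neg_one a]; exact mul_right_inj' ha.ne'
  have ey : ∀ X : ℝ, b * X = b ↔ X = 1 := fun X => by simp [hb.ne']
  have ey' : ∀ X : ℝ, b * X = -b ↔ X = -1 := fun X => by
    rw [← mul_neg_one b]; exact mul_right_inj' hb.ne'
  have ex0 : ∀ X : ℝ, a * X = 0 ↔ X = 0 := fun X => by simp [ha.ne']
  have ey0 : ∀ X : ℝ, b * X = 0 ↔ X = 0 := fun X => by simp [hb.ne']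
  have W1 : S = 0 ↔ horiz := by
    rw [V1]
    simp only [horiz, hX1, hX2, hX3, hY1, hY2, hY3, ex, ex', ey0]
  have W2 : K = 0 ↔ vert := by
    rw [V2]
    simp only [vert, hX1, hX2, hX3, hY1, hY2, hY3, ey, ey', ex0]
  exact ⟨⟨T1.1, T1.2.1, T2.1, T2.2.1⟩, T1.2.2.1.trans W1, T2.2.2.1.trans W1,
    T1.2.2.2.trans W2, T2.2.2.2.trans W2⟩
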